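/- arXiv:1805.08796 — 3 statements merged into one kernel-verified Lean document; each statement's English description precedes it below -/
import Mathlib

section
/- Fix p, r, s ∈ ℕ and elements g₀ ∈ GL_p(𝔽_q), h₀ ∈ GL_r(𝔽_q), x₀ ∈ GL_s(𝔽_q) such that rank(x₀ − 1) = rank(g₀ − 1) + rank(h₀ − 1). For each n ≥ max(p, r, s), let N(n) be the number of ordered pairs (g, h) ∈ GL_n(𝔽_q) × GL_n(𝔽_q) such that g is conjugate to g₀ ⊕ I_{n−p}, h is conjugate to h₀ ⊕ I_{n−r}, and g·h = x₀ ⊕ I_{n−s}. Then N(n) = N(m) for all n, m ≥ max(p, r, s, 2·rank(x₀ − 1) − rank((x₀ − 1)²)). (This is the stability of the top-degree structure constants a^ν_{λμ}(n) of the centers of the integral group algebras ℤ[GL_n(𝔽_q)] with respect to the reflection-length filtration.) -/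
open Matrix

variable {F : Type*} [Field F] [Fintype F] [DecidableEq F]

/-- The embedding of a `k × k` matrix `A` as `A ⊕ I_{n-k}` in `n × n` matrices. -/
def pad {k n : ℕ} (h : k ≤ n) (A : Matrix (Fin k) (Fin k) F) :
    Matrix (Fin n) (Fin n) F :=
  Matrix.reindex (finSumFinEquiv.trans (finCongr (Nat.add_sub_cancel' h)))
    (finSumFinEquiv.trans (finCongr (Nat.add_sub_cancel' h)))
    (Matrix.fromBlocks A 0 0 (1 : Matrix (Fin (n - k)) (Fin (n - k)) F))

/-- The number `N(n)` of pairs `(g, h)` in `GL_n(𝔽_q)` with `g` conjugate to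
`g₀ ⊕ I_{n-p}`, `h` conjugate to `h₀ ⊕ I_{n-r}`, and `g·h = x₀ ⊕ I_{n-s}`. -/
noncomputable def pairCount {p r s : ℕ} (g0 : GL (Fin p) F) (h0 : GL (Fin r) F)
    (x0 : GL (Fin s) F) (n : ℕ) (hp : p ≤ n) (hr : r ≤ n) (hs : s ≤ n) : ℕ :=
  Nat.card {gh : GL (Fin n) F × GL (Fin n) F |
    (∃ z : GL (Fin n) F, ((z * gh.1 * z⁻¹ : GL (Fin n) F) : Matrix (Fin n) (Fin n) F) =
      pad hp (g0 : Matrix (Fin p) (Fin p) F)) ∧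
    (∃ z : GL (Fin n) F, ((z * gh.2 * z⁻¹ : GL (Fin n) F) : Matrix (Fin n) (Fin n) F) =
      pad hr (h0 : Matrix (Fin r) (Fin r) F)) ∧
    ((gh.1 * gh.2 : GL (Fin n) F) : Matrix (Fin n) (Fin n) F) =
      pad hs (x0 : Matrix (Fin s) (Fin s) F)}

section Helpers

variable {α : Type*} [Fintype α] [DecidableEq α]

/-- Common fixed vectors of a rank-additive factorization. -/
theorem fixed_of_rank (G H X : Matrix α α F) (hX : G * H = X)
    (hr : (X - 1).rank = (G - 1).rank + (H - 1).rank) (v : α → F) (hv : X *ᵥ v = v) :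
    G *ᵥ v = v ∧ H *ᵥ v = v := by
  have key : LinearMap.ker (G - 1).mulVecLin ⊓ LinearMap.ker (H - 1).mulVecLin =
      LinearMap.ker (X - 1).mulVecLin := by
    apply Submodule.eq_of_le_of_finrank_le
    · intro w hw
      simp only [Submodule.mem_inf, LinearMap.mem_ker, mulVecLin_apply, sub_mulVec, one_mulVec,
        sub_eq_zero] at hw ⊢
      rw [← hX, ← mulVec_mulVec, hw.2, hw.1]
    · have h1 := LinearMap.finrank_range_add_finrank_ker (G - 1).mulVecLin
      have h2 := LinearMap.finrank_range_add_finrank_ker (H - 1).mulVecLin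
      have h3 := LinearMap.finrank_range_add_finrank_ker (X - 1).mulVecLin
      have h4 := Submodule.finrank_sup_add_finrank_inf_eq
        (LinearMap.ker (G - 1).mulVecLin) (LinearMap.ker (H - 1).mulVecLin)
      have h5 := Submodule.finrank_le
        (LinearMap.ker (G - 1).mulVecLin ⊔ LinearMap.ker (H - 1).mulVecLin)
      unfold Matrix.rank at hr
      omega
  have hv' : v ∈ LinearMap.ker (X - 1).mulVecLin := by
    simp [sub_mulVec, hv]
  rw [← key] at hv'
  simpa [sub_mulVec, sub_eq_zero] using hv'

/-- Cancellation of a trivial one-dimensional summand. -/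
theorem cancel_one (a : Matrix α α F) (b : Matrix α Unit F) (c : Matrix Unit α F)
    (d : Matrix Unit Unit F) (A B : Matrix α α F) (hdet : (fromBlocks a b c d).det ≠ 0)
    (h : fromBlocks a b c d * fromBlocks A 0 0 1 = fromBlocks B 0 0 1 * fromBlocks a b c d) :
    ∃ w : Matrix α α F, w.det ≠ 0 ∧ w * A = B * w := by
  simp only [fromBlocks_multiply, Matrix.mul_zero, Matrix.zero_mul, add_zero, zero_add,
    Matrix.mul_one, Matrix.one_mul, fromBlocks_inj] at h
  obtain ⟨haA, hb, hc, -⟩ := h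
  by_cases ha : a.det = 0
  · refine ⟨a + b * c, ?_, ?_⟩
    · have inj : ∀ (v : α → F) (t : Unit → F), a *ᵥ v + b *ᵥ t = 0 → c *ᵥ v + d *ᵥ t = 0 →
          v = 0 ∧ t = 0 := by
        intro v t h1 h2
        by_contra hne
        apply hdet
        rw [← exists_mulVec_eq_zero_iff]
        refine ⟨Sum.elim v t, ?_, ?_⟩
        · intro h0
          apply hne
          constructor
          · funext i; exact congrFun h0 (Sum.inl i)
          · funext i; exact congrFun h0 (Sum.inr i)
        · rw [fromBlocks_mulVec]
          simp [h1, h2]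
      obtain ⟨u, hu0, hu⟩ := exists_mulVec_eq_zero_iff.mpr ha
      intro hz
      obtain ⟨v, hv0, hv⟩ := exists_mulVec_eq_zero_iff.mpr hz
      rw [add_mulVec, ← mulVec_mulVec] at hv
      have hcu : (c *ᵥ u) () ≠ 0 := by
        intro h0
        have : c *ᵥ u = 0 := by funext i; exact h0
        exact hu0 (inj u 0 (by simp [hu]) (by simp [this])).1
      set l : F := (c *ᵥ v) () with hl
      set k : F := (c *ᵥ u) () with hk
      have h1 := inj (k • v - ((1 + d () ()) * l) • u) (k • (c *ᵥ v)) (by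
        rw [mulVec_sub, mulVec_smul, mulVec_smul, mulVec_smul, hu, smul_zero, sub_zero,
          ← smul_add, hv, smul_zero]) (by
        rw [mulVec_sub, mulVec_smul, mulVec_smul, mulVec_smul]
        funext i
        have hd : (d *ᵥ (c *ᵥ v)) () = d () () * l := by
          simp [mulVec, dotProduct, hl]
        simp only [Pi.add_apply, Pi.sub_apply, Pi.smul_apply, smul_eq_mul, Pi.zero_apply]
        rw [show i = () from rfl, hd, ← hl, ← hk]
        ring)
      have h2 : k * l = 0 := by
        have := congrFun h1.2 ()
        simpa [← hl] using this
      have h3 : l = 0 := (mul_eq_zero.mp h2).resolve_left hcu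
      have h4 := h1.1
      rw [h3, mul_zero, zero_smul, sub_zero] at h4
      exact hv0 ((smul_eq_zero.mp h4).resolve_left hcu)
    · rw [add_mul, mul_add, haA, Matrix.mul_assoc, hc, ← Matrix.mul_assoc, ← hb]
  · exact ⟨a, ha, haA⟩

theorem rank_blocks {β : Type*} [Fintype β] [DecidableEq β] (A : Matrix α α F) :
    (fromBlocks A 0 0 (0 : Matrix β β F)).rank = A.rank := by
  apply le_antisymm
  · have : fromBlocks A 0 0 (0 : Matrix β β F) =
        fromRows (1 : Matrix α α F) (0 : Matrix β α F) * (A *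
          fromCols (1 : Matrix α α F) (0 : Matrix α β F)) := by
      ext (i | i) (j | j) <;> simp [Matrix.mul_fromCols, Matrix.fromRows_mul]
    rw [this]
    exact (rank_mul_le_right _ _).trans (rank_mul_le_left _ _)
  · exact rank_submatrix_le (fromBlocks A 0 0 (0 : Matrix β β F)) Sum.inl Sum.inl

theorem rank_conj (z g : GL α F) (M : Matrix α α F)
    (h : ((z * g * z⁻¹ : GL α F) : Matrix α α F) = M) :
    ((g : Matrix α α F) - 1).rank = (M - 1).rank := by
  have : M - 1 = (z : Matrix α α F) * ((g : Matrix α α F) - 1) * ((z⁻¹ : GL α F) : Matrix α α F) := by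
    rw [← h, mul_sub, sub_mul, mul_one, ← Units.val_mul z z⁻¹, mul_inv_cancel]
    simp
  rw [this, rank_mul_eq_left_of_isUnit_det, rank_mul_eq_right_of_isUnit_det]
  · exact (Matrix.isUnit_iff_isUnit_det _).mp z.isUnit
  · exact (Matrix.isUnit_iff_isUnit_det _).mp (z⁻¹).isUnit

end Helpers

theorem rank_pad {k n : ℕ} (h : k ≤ n) (A : Matrix (Fin k) (Fin k) F) :
    (pad h A - 1).rank = (A - 1).rank := by
  have : pad h A - 1 = Matrix.reindex (finSumFinEquiv.trans (finCongr (Nat.add_sub_cancel' h)))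
    (finSumFinEquiv.trans (finCongr (Nat.add_sub_cancel' h)))
    (fromBlocks (A - 1) 0 0 (0 : Matrix (Fin (n - k)) (Fin (n - k)) F)) := by
    have h1 : fromBlocks (A - 1) 0 0 (0 : Matrix (Fin (n - k)) (Fin (n - k)) F) =
        fromBlocks A 0 0 1 - 1 := by
      rw [← fromBlocks_one, sub_eq_add_neg, sub_eq_add_neg, fromBlocks_neg, fromBlocks_add]
      simp
    rw [h1]
    unfold pad
    rw [reindex_apply, reindex_apply, submatrix_sub]
    simp only [Pi.sub_apply]
    rw [submatrix_one_equiv]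
  rw [this, rank_reindex, rank_blocks]

/-- Index equivalence adding one last coordinate. -/
def eqv (n : ℕ) : Fin n ⊕ Unit ≃ Fin (n + 1) :=
  (Equiv.sumCongr (Equiv.refl _) (Equiv.equivPUnit.{1, 1} (Fin 1)).symm).trans finSumFinEquiv

/-- The monoid homomorphism `A ↦ A ⊕ 1`. -/
def emb (n : ℕ) : Matrix (Fin n) (Fin n) F →* Matrix (Fin (n + 1)) (Fin (n + 1)) F where
  toFun A := Matrix.reindex (eqv n) (eqv n) (fromBlocks A 0 0 1)
  map_one' := by simp
  map_mul' A B := by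
    simp only [reindex_apply]
    rw [submatrix_mul_equiv, fromBlocks_multiply]
    simp

theorem emb_injective (n : ℕ) : Function.Injective (emb (F := F) n) := by
  intro A B h
  have h' := (Matrix.reindex (eqv n) (eqv n)).injective h
  exact (fromBlocks_inj.mp h').1

theorem pad_apply {k n : ℕ} (h : k ≤ n) (A : Matrix (Fin k) (Fin k) F) (i j : Fin n) :
    pad h A i j = if hh : (i : ℕ) < k ∧ (j : ℕ) < k then A ⟨i, hh.1⟩ ⟨j, hh.2⟩
      else if i = j then 1 else 0 := by
  obtain ⟨i, rfl⟩ := (finSumFinEquiv.trans (finCongr (Nat.add_sub_cancel' h))).surjective i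
  obtain ⟨j, rfl⟩ := (finSumFinEquiv.trans (finCongr (Nat.add_sub_cancel' h))).surjective j
  unfold pad
  rw [reindex_apply, submatrix_apply, Equiv.symm_apply_apply, Equiv.symm_apply_apply]
  rcases i with i | i <;> rcases j with j | j <;>
    simp [Matrix.one_apply, Fin.ext_iff]
  · omega
  · omega

theorem emb_apply {n : ℕ} (A : Matrix (Fin n) (Fin n) F) (i j : Fin (n + 1)) :
    emb n A i j = if hh : (i : ℕ) < n ∧ (j : ℕ) < n then A ⟨i, hh.1⟩ ⟨j, hh.2⟩
      else if i = j then 1 else 0 := by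
  obtain ⟨i, rfl⟩ := (eqv n).surjective i
  obtain ⟨j, rfl⟩ := (eqv n).surjective j
  show Matrix.reindex (eqv n) (eqv n) (fromBlocks A 0 0 1) _ _ = _
  rw [reindex_apply, submatrix_apply, Equiv.symm_apply_apply, Equiv.symm_apply_apply]
  rcases i with i | i <;> rcases j with j | j <;>
    simp [Matrix.one_apply, Fin.ext_iff, eqv]
  · omega
  · omega

theorem emb_pad {k n : ℕ} (h : k ≤ n) (h' : k ≤ n + 1) (A : Matrix (Fin k) (Fin k) F) :
    pad h' A = emb n (pad h A) := by
  ext i j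
  rw [pad_apply, emb_apply]
  by_cases h2 : (i : ℕ) < n ∧ (j : ℕ) < n
  · rw [dif_pos h2, pad_apply]
    simp only [Fin.ext_iff]
  · have h1 : ¬ ((i : ℕ) < k ∧ (j : ℕ) < k) := by omega
    rw [dif_neg h2, dif_neg h1]

/-- A matrix whose last row and column are trivial is in the image of `emb`. -/
theorem exists_emb {n : ℕ} (G : Matrix (Fin (n + 1)) (Fin (n + 1)) F)
    (hc : G *ᵥ Pi.single (Fin.last n) 1 = Pi.single (Fin.last n) 1)
    (hr : Gᵀ *ᵥ Pi.single (Fin.last n) 1 = Pi.single (Fin.last n) 1) :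
    ∃ A, emb n A = G := by
  refine ⟨G.submatrix Fin.castSucc Fin.castSucc, ?_⟩
  ext i j
  rw [emb_apply]
  have hc' := congrFun hc i
  have hr' := congrFun hr j
  simp only [mulVec_single, MulOpposite.op_one, one_smul, col_apply, transpose_apply] at hc' hr'
  split_ifs with h1 h2
  · rfl
  · subst h2
    have : i = Fin.last n := by ext; simp; omega
    subst this
    simp [hc']
  · by_cases hi : (i : ℕ) < n
    · have : j = Fin.last n := by ext; simp; omega
      subst this
      rw [hc', Pi.single_eq_of_ne h2]
    · have : i = Fin.last n := by ext; simp; omega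
      subst this
      rw [hr', Pi.single_eq_of_ne (Ne.symm h2)]

theorem conj_emb_iff {n : ℕ} (g : GL (Fin n) F) (M : Matrix (Fin n) (Fin n) F) :
    (∃ z : GL (Fin (n + 1)) F, ((z * Units.map (emb n) g * z⁻¹ : GL (Fin (n + 1)) F) :
      Matrix (Fin (n + 1)) (Fin (n + 1)) F) = emb n M) ↔
    ∃ z : GL (Fin n) F, ((z * g * z⁻¹ : GL (Fin n) F) : Matrix (Fin n) (Fin n) F) = M := by
  constructor
  · rintro ⟨z, hz⟩
    obtain ⟨Z, hZ⟩ := (Matrix.reindex (eqv n) (eqv n)).surjective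
      (z : Matrix (Fin (n + 1)) (Fin (n + 1)) F)
    have h1 : (z : Matrix (Fin (n + 1)) (Fin (n + 1)) F) * emb n g =
        emb n M * (z : Matrix (Fin (n + 1)) (Fin (n + 1)) F) := by
      rw [← hz]
      simp only [← Units.val_mul, ← Units.coe_map, MonoidHom.coe_coe]
      simp [mul_assoc]
    have hdet : Z.det ≠ 0 := by
      rw [← det_reindex_self (eqv n), hZ]
      exact ((Matrix.isUnit_iff_isUnit_det _).mp z.isUnit).ne_zero
    have h2 : Z * fromBlocks (g : Matrix (Fin n) (Fin n) F) 0 0 1 = fromBlocks M 0 0 1 * Z := by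
      apply (Matrix.reindex (eqv n) (eqv n)).injective
      rw [← hZ] at h1
      simp only [reindex_apply] at h1 ⊢
      rw [← submatrix_mul_equiv _ _ _ (eqv n).symm, ← submatrix_mul_equiv _ _ _ (eqv n).symm]
      exact h1
    rw [← fromBlocks_toBlocks Z] at h2 hdet
    obtain ⟨w, hw, hwA⟩ := cancel_one _ _ _ _ _ _ hdet h2
    refine ⟨GeneralLinearGroup.mkOfDetNeZero w hw, ?_⟩
    rw [Units.val_mul, Units.val_mul]
    have : ((GeneralLinearGroup.mkOfDetNeZero w hw : GL (Fin n) F) : Matrix (Fin n) (Fin n) F)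
      = w := rfl
    rw [this, hwA]
    nth_rewrite 1 [← this]
    rw [Matrix.mul_assoc, ← Units.val_mul, mul_inv_cancel]
    simp
  · rintro ⟨z, rfl⟩
    refine ⟨Units.map (emb n) z, ?_⟩
    rw [← map_inv, ← map_mul, ← map_mul]
    rfl

theorem pairCount_succ {p r s : ℕ} (g0 : GL (Fin p) F) (h0 : GL (Fin r) F)
    (x0 : GL (Fin s) F)
    (hrank : ((x0 : Matrix (Fin s) (Fin s) F) - 1).rank =
      ((g0 : Matrix (Fin p) (Fin p) F) - 1).rank +
        ((h0 : Matrix (Fin r) (Fin r) F) - 1).rank)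
    {n : ℕ} (hp : p ≤ n) (hr : r ≤ n) (hs : s ≤ n)
    (hp' : p ≤ n + 1) (hr' : r ≤ n + 1) (hs' : s ≤ n + 1) :
    pairCount g0 h0 x0 (n + 1) hp' hr' hs' = pairCount g0 h0 x0 n hp hr hs := by
  have hinj : Function.Injective (Units.map (emb (F := F) n)) := Units.map_injective (emb_injective n)
  unfold pairCount
  rw [← Nat.card_image_of_injective (Prod.map_injective.mpr ⟨hinj, hinj⟩)]
  congr 1
  congr 1
  ext ⟨g, h⟩
  simp only [Set.mem_ofPred_eq, Set.mem_image, Prod.exists, Prod.map_apply, Prod.mk.injEq]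
  rw [emb_pad hp hp', emb_pad hr hr', emb_pad hs hs']
  constructor
  · rintro ⟨hg, hh, hx⟩
    have hrk : ((emb n (pad hs (x0 : Matrix (Fin s) (Fin s) F))) - 1).rank =
        ((g : Matrix (Fin (n + 1)) (Fin (n + 1)) F) - 1).rank +
        ((h : Matrix (Fin (n + 1)) (Fin (n + 1)) F) - 1).rank := by
      obtain ⟨z, hz⟩ := hg
      obtain ⟨y, hy⟩ := hh
      rw [rank_conj z g _ hz, rank_conj y h _ hy, ← emb_pad hp hp', ← emb_pad hr hr',
        ← emb_pad hs hs', rank_pad, rank_pad, rank_pad, hrank]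
    have hfix : ∀ M : Matrix (Fin n) (Fin n) F,
        emb n M *ᵥ Pi.single (Fin.last n) 1 = Pi.single (Fin.last n) 1 := by
      intro M
      funext i
      simp [emb_apply, Pi.single_apply]
    have hfixT : ∀ M : Matrix (Fin n) (Fin n) F,
        (emb n M)ᵀ *ᵥ Pi.single (Fin.last n) 1 = Pi.single (Fin.last n) 1 := by
      intro M
      funext i
      simp [emb_apply, Pi.single_apply, eq_comm]
    rw [Units.val_mul] at hx
    have c1 := fixed_of_rank _ _ _ hx hrk _ (hfix _)
    have hxT := congrArg Matrix.transpose hx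
    rw [transpose_mul] at hxT
    have tr : ∀ M : Matrix (Fin (n + 1)) (Fin (n + 1)) F, (Mᵀ - 1).rank = (M - 1).rank := by
      intro M
      rw [← rank_transpose (M - 1), transpose_sub, transpose_one]
    have c2 := fixed_of_rank _ _ _ hxT (by rw [tr, tr, tr, hrk, add_comm]) _ (hfixT _)
    have lift : ∀ g : GL (Fin (n + 1)) F,
        (g : Matrix (Fin (n + 1)) (Fin (n + 1)) F) *ᵥ Pi.single (Fin.last n) 1 =
          Pi.single (Fin.last n) 1 →
        (g : Matrix (Fin (n + 1)) (Fin (n + 1)) F)ᵀ *ᵥ Pi.single (Fin.last n) 1 =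
          Pi.single (Fin.last n) 1 → ∃ g' : GL (Fin n) F, Units.map (emb n) g' = g := by
      intro g h1 h2
      obtain ⟨A, hA⟩ := exists_emb _ h1 h2
      have hd : A.det ≠ 0 := by
        have : (emb n A).det ≠ 0 := by
          rw [hA]
          exact ((Matrix.isUnit_iff_isUnit_det _).mp g.isUnit).ne_zero
        intro h0
        apply this
        show (Matrix.reindex (eqv n) (eqv n) (fromBlocks A 0 0 1)).det = 0
        rw [det_reindex_self, det_fromBlocks_zero₂₁, h0, zero_mul]
      refine ⟨GeneralLinearGroup.mkOfDetNeZero A hd, Units.ext ?_⟩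
      exact hA
    obtain ⟨g', rfl⟩ := lift g c1.1 c2.2
    obtain ⟨h', rfl⟩ := lift h c1.2 c2.1
    refine ⟨g', h', ⟨(conj_emb_iff _ _).mp hg, (conj_emb_iff _ _).mp hh, ?_⟩, rfl, rfl⟩
    apply emb_injective n
    rw [← hx, Units.val_mul, map_mul]
    rfl
  · rintro ⟨g', h', ⟨hg, hh, hx⟩, rfl, rfl⟩
    refine ⟨(conj_emb_iff _ _).mpr hg, (conj_emb_iff _ _).mpr hh, ?_⟩
    rw [← hx, ← map_mul]
    rfl

theorem pairCount_le {p r s : ℕ} (g0 : GL (Fin p) F) (h0 : GL (Fin r) F)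
    (x0 : GL (Fin s) F)
    (hrank : ((x0 : Matrix (Fin s) (Fin s) F) - 1).rank =
      ((g0 : Matrix (Fin p) (Fin p) F) - 1).rank +
        ((h0 : Matrix (Fin r) (Fin r) F) - 1).rank)
    {n : ℕ} (hp : p ≤ n) (hr : r ≤ n) (hs : s ≤ n) (k : ℕ) :
    pairCount g0 h0 x0 (n + k) (by omega) (by omega) (by omega) =
      pairCount g0 h0 x0 n hp hr hs := by
  induction k with
  | zero => rfl
  | succ k ih =>
    rw [← ih]
    exact pairCount_succ g0 h0 x0 hrank (n := n + k) _ _ _ _ _ _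

/-- Stability of the top-degree structure constants: if
`rank(x₀ - 1) = rank(g₀ - 1) + rank(h₀ - 1)`, then the count `N(n)` is the same
for all `n ≥ max(p, r, s, 2·rank(x₀ - 1) - rank((x₀ - 1)²))`. -/
theorem pairCount_stable {p r s : ℕ} (g0 : GL (Fin p) F) (h0 : GL (Fin r) F)
    (x0 : GL (Fin s) F)
    (hrank : ((x0 : Matrix (Fin s) (Fin s) F) - 1).rank =
      ((g0 : Matrix (Fin p) (Fin p) F) - 1).rank +
        ((h0 : Matrix (Fin r) (Fin r) F) - 1).rank)
    {n m : ℕ} (hpn : p ≤ n) (hrn : r ≤ n) (hsn : s ≤ n)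
    (hkn : 2 * ((x0 : Matrix (Fin s) (Fin s) F) - 1).rank -
      (((x0 : Matrix (Fin s) (Fin s) F) - 1) ^ 2).rank ≤ n)
    (hpm : p ≤ m) (hrm : r ≤ m) (hsm : s ≤ m)
    (hkm : 2 * ((x0 : Matrix (Fin s) (Fin s) F) - 1).rank -
      (((x0 : Matrix (Fin s) (Fin s) F) - 1) ^ 2).rank ≤ m) :
    pairCount g0 h0 x0 n hpn hrn hsn = pairCount g0 h0 x0 m hpm hrm hsm := by
  rcases le_total n m with h | h
  · obtain ⟨k, rfl⟩ := Nat.exists_eq_add_of_le h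
    exact (pairCount_le g0 h0 x0 hrank hpn hrn hsn k).symm
  · obtain ⟨k, rfl⟩ := Nat.exists_eq_add_of_le h
    exact pairCount_le g0 h0 x0 hrank hpm hrm hsm k
end

section
/- Let ξ, η ∈ 𝔽_q \ {0}, and let f(t) = t² + b t + c be a monic irreducible polynomial over 𝔽_q. Let N be the number of ordered pairs (g, h) ∈ GL_2(𝔽_q) × GL_2(𝔽_q) with g conjugate to r(ξ), h conjugate to r(η), and g·h equal to the companion matrix [[0, 1], [−c, −b]] of f. Then N = q + 1 if c = ξη, and N = 0 otherwise. -/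
open Matrix Polynomial

variable {F : Type*} [Field F] [Fintype F] [DecidableEq F]

/-- The representative reflection of modified type `(1)_{t-ξ}`:
`diag(ξ, 1)` if `ξ ≠ 1`, and the transvection `[[1,1],[0,1]]` if `ξ = 1`. -/
def refl2 (ξ : F) : Matrix (Fin 2) (Fin 2) F :=
  if ξ = 1 then !![1, 1; 0, 1] else !![ξ, 0; 0, 1]

theorem conj_of_mul (g : GL (Fin 2) F) (r P : Matrix (Fin 2) (Fin 2) F) (hP : P.det ≠ 0)
    (h : P * (g : Matrix (Fin 2) (Fin 2) F) = r * P) :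
    ∃ z : GL (Fin 2) F, ((z * g * z⁻¹ : GL (Fin 2) F) : Matrix (Fin 2) (Fin 2) F) = r := by
  have hu : IsUnit P.det := isUnit_iff_ne_zero.mpr hP
  refine ⟨Matrix.GeneralLinearGroup.mkOfDetNeZero P hP, ?_⟩
  rw [Units.val_mul, Units.val_mul, Matrix.coe_units_inv]
  change P * (g : Matrix (Fin 2) (Fin 2) F) * P⁻¹ = r
  rw [h, Matrix.mul_assoc, Matrix.mul_nonsing_inv _ hu, Matrix.mul_one]

theorem conj_iff (ξ : F) (g : GL (Fin 2) F) :
    (∃ z : GL (Fin 2) F,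
        ((z * g * z⁻¹ : GL (Fin 2) F) : Matrix (Fin 2) (Fin 2) F) = refl2 ξ) ↔
      g ≠ 1 ∧ (g : Matrix (Fin 2) (Fin 2) F).trace = 1 + ξ ∧
        (g : Matrix (Fin 2) (Fin 2) F).det = ξ := by
  constructor
  · rintro ⟨z, hz⟩
    refine ⟨?_, ?_, ?_⟩
    · rintro rfl
      simp only [mul_one, mul_inv_cancel, Units.val_one] at hz
      unfold refl2 at hz
      split_ifs at hz with h
      · have := congrFun (congrFun hz 0) 1
        simp at this
      · have := congrFun (congrFun hz 0) 0
        simp at this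
        exact h this.symm
    · have h1 := congrArg Matrix.trace hz
      rw [Units.val_mul, Matrix.trace_mul_comm, ← Units.val_mul, ← mul_assoc, inv_mul_cancel,
        one_mul] at h1
      rw [h1]
      unfold refl2
      split_ifs with h
      · simp [Matrix.trace_fin_two, h]
      · simp [Matrix.trace_fin_two, add_comm]
    · have h1 := congrArg Matrix.det hz
      rw [Units.val_mul, Matrix.det_mul_comm, ← Units.val_mul, ← mul_assoc, inv_mul_cancel,
        one_mul] at h1
      rw [h1]
      unfold refl2
      split_ifs with h
      · simp [Matrix.det_fin_two, h]
      · simp [Matrix.det_fin_two]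
  · rintro ⟨h1, ht, hd⟩
    have hg : (g : Matrix (Fin 2) (Fin 2) F) ≠ 1 := fun h => h1 (Units.ext h)
    obtain ⟨x, y, z, w, hM⟩ : ∃ x y z w, (g : Matrix (Fin 2) (Fin 2) F) = !![x, y; z, w] :=
      ⟨_, _, _, _, Matrix.eta_fin_two _⟩
    rw [hM] at ht hd hg
    simp only [Matrix.trace_fin_two_of, Matrix.det_fin_two_of] at ht hd
    obtain rfl : w = 1 + ξ - x := by rw [← ht]; ring
    by_cases hx : ξ = 1
    · subst hx
      have hr : refl2 (1 : F) = !![1, 1; 0, 1] := by simp [refl2]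
      rw [hr]
      by_cases hy : y = 0
      · by_cases hz : z = 0
        · subst hy hz
          exfalso
          have : (x - 1) ^ 2 = 0 := by linear_combination -hd
          have : x - 1 = 0 := by simpa using this
          obtain rfl : x = 1 := by linear_combination this
          apply hg
          rw [Matrix.one_fin_two]
          simp
        · refine conj_of_mul g _ !![0, 1; z, 1 + 1 - x - 1] ?_ ?_
          · simpa [Matrix.det_fin_two] using hz
          · rw [hM]
            ext i j
            fin_cases i <;> fin_cases j <;> simp [Matrix.mul_apply, Fin.sum_univ_two] <;>
              grind
      · refine conj_of_mul g _ !![1, 0; x - 1, y] ?_ ?_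
        · simpa [Matrix.det_fin_two] using hy
        · rw [hM]
          ext i j
          fin_cases i <;> fin_cases j <;> simp [Matrix.mul_apply, Fin.sum_univ_two] <;>
            grind
    · have hr : refl2 ξ = !![ξ, 0; 0, 1] := by simp [refl2, hx]
      have hx' : ξ - 1 ≠ 0 := sub_ne_zero.mpr hx
      rw [hr]
      by_cases hy : y = 0
      · by_cases hz : z = 0
        · subst hy hz
          have : (x - 1) * (x - ξ) = 0 := by linear_combination -hd
          rcases mul_eq_zero.mp this with h | h
          · obtain rfl : x = 1 := by linear_combination h
            refine conj_of_mul g _ !![0, 1; 1, 0] ?_ ?_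
            · simp [Matrix.det_fin_two]
            · rw [hM]
              ext i j
              fin_cases i <;> fin_cases j <;> simp [Matrix.mul_apply, Fin.sum_univ_two]
          · obtain rfl : x = ξ := by linear_combination h
            refine conj_of_mul g _ 1 ?_ ?_
            · simp
            · rw [hM]; simp
        · refine conj_of_mul g _ !![z, ξ - x; z, 1 - x] ?_ ?_
          · have : z * (1 - x) - (ξ - x) * z = - (z * (ξ - 1)) := by ring
            simp [Matrix.det_fin_two, this, hz, hx']
          · rw [hM]
            ext i j
            fin_cases i <;> fin_cases j <;> simp [Matrix.mul_apply, Fin.sum_univ_two] <;> grind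
      · refine conj_of_mul g _ !![x - 1, y; x - ξ, y] ?_ ?_
        · have : (x - 1) * y - y * (x - ξ) = y * (ξ - 1) := by ring
          simp [Matrix.det_fin_two, this, hy, hx']
        · rw [hM]
          ext i j
          fin_cases i <;> fin_cases j <;> simp [Matrix.mul_apply, Fin.sum_univ_two] <;> grind

theorem conic_card (ξ b c : F) (hf : ∀ t : F, t ^ 2 + b * t + c ≠ 0) :
    Nat.card {p : F × F // p.1 ^ 2 - b * p.1 * p.2 + c * p.2 ^ 2
      = (ξ - 1) * p.1 + (b + ξ + c) * p.2} = Fintype.card F + 1 := by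
  have hQ : ∀ s : F, s ^ 2 - b * s + c ≠ 0 := fun s h => hf (-s) (by linear_combination h)
  rw [← Fintype.card_option, ← Nat.card_eq_fintype_card]
  symm
  let φ : Option F → {p : F × F // p.1 ^ 2 - b * p.1 * p.2 + c * p.2 ^ 2
      = (ξ - 1) * p.1 + (b + ξ + c) * p.2} := fun o => match o with
    | none => ⟨(ξ - 1, 0), by ring⟩
    | some s => ⟨(((ξ - 1) * s + (b + ξ + c)) / (s ^ 2 - b * s + c) * s,
        ((ξ - 1) * s + (b + ξ + c)) / (s ^ 2 - b * s + c)), by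
          have := hQ s
          simp only
          field_simp⟩
  have h1 : ξ = 1 → b + ξ + c ≠ 0 := by
    rintro rfl h
    exact hf 1 (by linear_combination h)
  refine Nat.card_congr (Equiv.ofBijective φ ⟨?_, ?_⟩)
  · have key : ∀ s : F, φ none ≠ φ (some s) := by
      intro s h
      have h2 := congrArg (fun p => p.1.1) h
      have h3 := congrArg (fun p => p.1.2) h
      simp only [φ] at h2 h3
      rw [← h3, zero_mul] at h2
      rw [eq_comm, div_eq_zero_iff] at h3
      have h4 := h3.resolve_right (hQ s)
      rw [h2] at h4
      exact h1 (by linear_combination h2) (by linear_combination h4)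
    rintro (_ | s) (_ | s') h
    · rfl
    · exact (key _ h).elim
    · exact (key _ h.symm).elim
    · have h2 := congrArg (fun p => p.1.1) h
      have h3 := congrArg (fun p => p.1.2) h
      simp only [φ] at h2 h3
      rw [← h3] at h2
      by_cases h0 : ((ξ - 1) * s + (b + ξ + c)) / (s ^ 2 - b * s + c) = 0
      · have h0' := h3.symm.trans h0
        have h4 := (div_eq_zero_iff.mp h0).resolve_right (hQ s)
        have h5 := (div_eq_zero_iff.mp h0').resolve_right (hQ s')
        have h6 : (ξ - 1) * (s - s') = 0 := by linear_combination h4 - h5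
        rcases mul_eq_zero.mp h6 with h7 | h7
        · refine (h1 (by linear_combination h7) ?_).elim
          linear_combination h4 - s * h7
        · rw [sub_eq_zero.mp h7]
      · rw [mul_left_cancel₀ h0 h2]
  · rintro ⟨⟨u, y⟩, hp⟩
    simp only at hp
    by_cases hy : y = 0
    · subst hy
      by_cases hu : u = ξ - 1
      · exact ⟨none, by simp [φ, hu]⟩
      · have h2 : u * (u - (ξ - 1)) = 0 := by linear_combination hp
        have h3 : u = 0 := (mul_eq_zero.mp h2).resolve_right (sub_ne_zero.mpr hu)
        subst h3
        have hx : ξ - 1 ≠ 0 := fun h => hu h.symm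
        refine ⟨some (-(b + ξ + c) / (ξ - 1)), ?_⟩
        have : (ξ - 1) * (-(b + ξ + c) / (ξ - 1)) + (b + ξ + c) = 0 := by
          field_simp; ring
        simp only [φ, this, zero_div, zero_mul]
    · refine ⟨some (u / y), ?_⟩
      have h2 : ((ξ - 1) * (u / y) + (b + ξ + c)) / ((u / y) ^ 2 - b * (u / y) + c) = y := by
        rw [div_eq_iff (hQ _)]
        field_simp
        linear_combination -hp
      simp only [φ, h2]
      ext
      · simp only; field_simp
      · rfl

theorem factor_aux (ξ η b c : F) (g h : GL (Fin 2) F)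
    (gt : (g : Matrix (Fin 2) (Fin 2) F).trace = 1 + ξ)
    (gd : (g : Matrix (Fin 2) (Fin 2) F).det = ξ)
    (ht : (h : Matrix (Fin 2) (Fin 2) F).trace = 1 + η)
    (hm : ((g * h : GL (Fin 2) F) : Matrix (Fin 2) (Fin 2) F) = !![0, 1; -c, -b]) :
    ∃ x y : F, (g : Matrix (Fin 2) (Fin 2) F) =
      !![x, y; c * y - b * x - ξ * (1 + η), 1 + ξ - x] := by
  have h1 : (g : Matrix (Fin 2) (Fin 2) F).adjugate * !![0, 1; -c, -b]
      = ξ • (h : Matrix (Fin 2) (Fin 2) F) := by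
    rw [← hm, Units.val_mul, ← Matrix.mul_assoc, Matrix.adjugate_mul, gd, Matrix.smul_mul,
      Matrix.one_mul]
  have h2 := congrArg Matrix.trace h1
  rw [Matrix.trace_smul, ht] at h2
  obtain ⟨x, y, z, w, hM⟩ : ∃ x y z w, (g : Matrix (Fin 2) (Fin 2) F) = !![x, y; z, w] :=
    ⟨_, _, _, _, Matrix.eta_fin_two _⟩
  rw [hM] at h2 gt
  rw [Matrix.trace_fin_two_of] at gt
  simp [Matrix.adjugate_fin_two_of, Matrix.trace_fin_two] at h2
  refine ⟨x, y, ?_⟩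
  rw [hM]
  congr 1
  have e1 : z = c * y - b * x - ξ * (1 + η) := by linear_combination -h2
  have e2 : w = 1 + ξ - x := by linear_combination gt
  rw [e1, e2]

/-- Let `f(t) = t² + b t + c` be irreducible over `𝔽_q`. The number of pairs
`(g, h)` in `GL_2(𝔽_q)` with `g ∼ r(ξ)`, `h ∼ r(η)` and `g·h` equal to the
companion matrix of `f` is `q + 1` if `c = ξη`, and `0` otherwise. -/
theorem structure_constant_two_reflections_irreducible (q : ℕ)
    (hq : Fintype.card F = q) (ξ η b c : F) (hξ : ξ ≠ 0) (hη : η ≠ 0)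
    (hf : Irreducible (X ^ 2 + C b * X + C c : F[X])) :
    Nat.card {gh : GL (Fin 2) F × GL (Fin 2) F |
      (∃ z : GL (Fin 2) F,
        ((z * gh.1 * z⁻¹ : GL (Fin 2) F) : Matrix (Fin 2) (Fin 2) F) = refl2 ξ) ∧
      (∃ z : GL (Fin 2) F,
        ((z * gh.2 * z⁻¹ : GL (Fin 2) F) : Matrix (Fin 2) (Fin 2) F) = refl2 η) ∧
      ((gh.1 * gh.2 : GL (Fin 2) F) : Matrix (Fin 2) (Fin 2) F) = !![0, 1; -c, -b]} =
    if c = ξ * η then q + 1 else 0 := by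
  have hroot : ∀ t : F, t ^ 2 + b * t + c ≠ 0 := by
    intro t ht
    have hdeg : (X ^ 2 + C b * X + C c : F[X]).natDegree = 2 := by compute_degree!
    refine hf.not_isRoot_of_natDegree_ne_one (by rw [hdeg]; norm_num) (x := t) ?_
    simpa [Polynomial.IsRoot] using ht
  have hdetM : ∀ gh : GL (Fin 2) F × GL (Fin 2) F,
      ((gh.1 * gh.2 : GL (Fin 2) F) : Matrix (Fin 2) (Fin 2) F) = !![0, 1; -c, -b] →
      (gh.1 : Matrix (Fin 2) (Fin 2) F).det * (gh.2 : Matrix (Fin 2) (Fin 2) F).det = c := by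
    intro gh h
    have := congrArg Matrix.det h
    rw [Units.val_mul, Matrix.det_mul] at this
    rw [this]
    simp [Matrix.det_fin_two]
  simp only [conj_iff]
  split_ifs with hc
  swap
  · rw [Nat.card_eq_zero]
    left
    constructor
    rintro ⟨gh, ⟨_, _, h1⟩, ⟨_, _, h2⟩, h3⟩
    apply hc
    rw [← hdetM gh h3, h1, h2]
  rw [← hq, ← conic_card ξ b c hroot]
  have hc0 : c ≠ 0 := by rw [hc]; exact mul_ne_zero hξ hη
  have hMdet : (!![0, 1; -c, -b] : Matrix (Fin 2) (Fin 2) F).det ≠ 0 := by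
    simpa [Matrix.det_fin_two] using hc0
  -- if either factor is trivial, the product would have eigenvalue one
  have hMtr : ∀ t : F, (!![0, 1; -c, -b] : Matrix (Fin 2) (Fin 2) F).trace = 1 + t →
      (!![0, 1; -c, -b] : Matrix (Fin 2) (Fin 2) F).det = t → False := by
    intro t h1 h2
    simp [Matrix.trace_fin_two, Matrix.det_fin_two] at h1 h2
    exact hroot 1 (by linear_combination -h1 + h2)
  refine Nat.card_congr (Equiv.ofBijective (fun gh => ⟨((gh.1.1 : Matrix (Fin 2) (Fin 2) F) 0 0 - 1,
    (gh.1.1 : Matrix (Fin 2) (Fin 2) F) 0 1), ?_⟩) ⟨?_, ?_⟩)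
  · obtain ⟨⟨g, h⟩, ⟨_, gt, gd⟩, ⟨_, ht, hd⟩, hm⟩ := gh
    obtain ⟨x, y, hM⟩ := factor_aux ξ η b c g h gt gd ht hm
    simp only [hM]
    rw [hM, Matrix.det_fin_two_of] at gd
    simp
    linear_combination -gd - y * hc
  · rintro ⟨⟨g, h⟩, ⟨_, gt, gd⟩, ⟨_, ht, hd⟩, hm⟩ ⟨⟨g', h'⟩, ⟨_, gt', gd'⟩, ⟨_, ht', hd'⟩, hm'⟩ he
    obtain ⟨x, y, hM⟩ := factor_aux ξ η b c g h gt gd ht hm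
    obtain ⟨x', y', hM'⟩ := factor_aux ξ η b c g' h' gt' gd' ht' hm'
    simp [hM, hM'] at he
    obtain ⟨e1, e2⟩ := he
    have eg : g = g' := by
      apply Units.ext
      rw [hM, hM', e1, e2]
    subst eg
    have eh : h = h' := mul_left_cancel (Units.ext (hm.trans hm'.symm))
    subst eh
    rfl
  · rintro ⟨⟨u, y⟩, hp⟩
    simp only at hp
    have hGd : (!![u + 1, y; c * y - b * (u + 1) - ξ * (1 + η), 1 + ξ - (u + 1)] :
        Matrix (Fin 2) (Fin 2) F).det = ξ := by
      rw [Matrix.det_fin_two_of]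
      linear_combination -hp - y * hc
    generalize hG : (!![u + 1, y; c * y - b * (u + 1) - ξ * (1 + η), 1 + ξ - (u + 1)] :
        Matrix (Fin 2) (Fin 2) F) = G at hGd
    let g := Matrix.GeneralLinearGroup.mkOfDetNeZero G (by rw [hGd]; exact hξ)
    let m := Matrix.GeneralLinearGroup.mkOfDetNeZero _ hMdet
    have hgv : (g : Matrix (Fin 2) (Fin 2) F) = G := rfl
    have hmv : (m : Matrix (Fin 2) (Fin 2) F) = !![0, 1; -c, -b] := rfl
    have hgh : g * (g⁻¹ * m) = m := by group
    have hGt : G.trace = 1 + ξ := by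
      rw [← hG, Matrix.trace_fin_two_of]; ring
    have hhd : ((g⁻¹ * m : GL (Fin 2) F) : Matrix (Fin 2) (Fin 2) F).det = η := by
      have := hdetM (g, g⁻¹ * m) (by simp only [hgh]; exact hmv)
      simp only [hgv, hGd] at this
      rw [hc] at this
      exact mul_left_cancel₀ hξ this
    have hht : ((g⁻¹ * m : GL (Fin 2) F) : Matrix (Fin 2) (Fin 2) F).trace = 1 + η := by
      have h1 : G.adjugate * !![0, 1; -c, -b]
          = ξ • ((g⁻¹ * m : GL (Fin 2) F) : Matrix (Fin 2) (Fin 2) F) := by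
        rw [← hmv, ← hgh, Units.val_mul g, hgv, ← Matrix.mul_assoc, Matrix.adjugate_mul, hGd,
          Matrix.smul_mul, Matrix.one_mul, hgh]
      have h2 := congrArg Matrix.trace h1
      rw [Matrix.trace_smul, ← hG] at h2
      simp only [Matrix.adjugate_fin_two_of, Matrix.trace_fin_two, Matrix.mul_apply,
        Fin.sum_univ_two, smul_eq_mul] at h2
      rw [Matrix.trace_fin_two]
      apply mul_left_cancel₀ hξ
      rw [← Matrix.trace_fin_two] at h2 ⊢
      rw [← h2]
      simp
      ring
    refine ⟨⟨(g, g⁻¹ * m), ⟨?_, hGt, hGd⟩, ⟨?_, hht, hhd⟩, by simp only [hgh]; exact hmv⟩, ?_⟩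
    · intro h1
      simp only at h1
      rw [h1, inv_one, one_mul, hmv] at hht hhd
      exact hMtr _ hht hhd
    · intro h1
      simp only at h1
      rw [h1, mul_one] at hgh
      rw [← hgv, hgh, hmv] at hGt hGd
      exact hMtr _ hGt hGd
    · apply Subtype.ext
      simp [hgv, ← hG]
end

section
/- The number of ordered pairs (g, h) ∈ GL_3(𝔽_q) × GL_3(𝔽_q) such that g is conjugate to J_2(1) ⊕ I_1, h is conjugate to J_2(1) ⊕ I_1, and g·h = J_3(1), equals 2q. (This is the structure constant a^{(2)_{t−1}}_{(1)_{t−1}, (1)_{t−1}} of the stable center.) -/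
open Matrix

variable {F : Type*} [Field F] [Fintype F] [DecidableEq F]

/-- The unipotent upper triangular matrix with entries `a, b, c` above the diagonal. -/
def uniU {K : Type*} [Field K] (a b c : K) : GL (Fin 3) K where
  val := !![1, a, b; 0, 1, c; 0, 0, 1]
  inv := !![1, -a, a * c - b; 0, 1, -c; 0, 0, 1]
  val_inv := by
    ext i j; fin_cases i <;> fin_cases j <;> simp [Matrix.mul_apply, Fin.sum_univ_three] <;> ring
  inv_val := by
    ext i j; fin_cases i <;> fin_cases j <;> simp [Matrix.mul_apply, Fin.sum_univ_three] <;> ring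

/-- A conjugating element. -/
def conjZ {K : Type*} [Field K] (b : K) : GL (Fin 3) K where
  val := !![0, 1, 0; 0, 0, 1; 1, -b, 0]
  inv := !![b, 0, 1; 1, 0, 0; 0, 1, 0]
  val_inv := by
    ext i j; fin_cases i <;> fin_cases j <;> simp [Matrix.mul_apply, Fin.sum_univ_three]
  inv_val := by
    ext i j; fin_cases i <;> fin_cases j <;> simp [Matrix.mul_apply, Fin.sum_univ_three]

theorem conj_first {K : Type*} [Field K] (c : K) : ∃ z : GL (Fin 3) K,
    ((z * uniU 1 c 0 * z⁻¹ : GL (Fin 3) K) : Matrix (Fin 3) (Fin 3) K) =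
      !![1, 1, 0; 0, 1, 0; 0, 0, 1] := by
  refine ⟨uniU 0 0 c, ?_⟩
  change (!![1, 0, 0; 0, 1, c; 0, 0, 1] : Matrix (Fin 3) (Fin 3) K) *
    !![1, 1, c; 0, 1, 0; 0, 0, 1] * !![1, -0, 0 * c - 0; 0, 1, -c; 0, 0, 1] = _
  ext i j; fin_cases i <;> fin_cases j <;> simp [Matrix.mul_apply, Fin.sum_univ_three]

theorem conj_second {K : Type*} [Field K] (b : K) : ∃ z : GL (Fin 3) K,
    ((z * uniU 0 b 1 * z⁻¹ : GL (Fin 3) K) : Matrix (Fin 3) (Fin 3) K) =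
      !![1, 1, 0; 0, 1, 0; 0, 0, 1] := by
  refine ⟨conjZ b, ?_⟩
  change (!![0, 1, 0; 0, 0, 1; 1, -b, 0] : Matrix (Fin 3) (Fin 3) K) *
    !![1, 0, b; 0, 1, 1; 0, 0, 1] * !![b, 0, 1; 1, 0, 0; 0, 1, 0] = _
  ext i j; fin_cases i <;> fin_cases j <;> simp [Matrix.mul_apply, Fin.sum_univ_three]

theorem conj_outer {K : Type*} [Field K] (g : GL (Fin 3) K) (h : ∃ z : GL (Fin 3) K,
    ((z * g * z⁻¹ : GL (Fin 3) K) : Matrix (Fin 3) (Fin 3) K) =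
      !![1, 1, 0; 0, 1, 0; 0, 0, 1]) :
    ∃ u v : Fin 3 → K, (∀ i j, g.1 i j = (1 : Matrix (Fin 3) (Fin 3) K) i j + u i * v j) ∧
      v 0 * u 0 + v 1 * u 1 + v 2 * u 2 = 0 := by
  obtain ⟨z, hz⟩ := h
  have hzz : z.1 * (z⁻¹).1 = 1 := by rw [← Units.val_mul]; simp
  have hzz' : (z⁻¹).1 * z.1 = 1 := by rw [← Units.val_mul]; simp
  have hg : g.1 = (z⁻¹).1 * !![1, 1, 0; 0, 1, 0; 0, 0, 1] * z.1 := by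
    rw [← hz, ← Units.val_mul, ← Units.val_mul]
    congr 1
    group
  refine ⟨fun i => (z⁻¹).1 i 0, fun j => z.1 1 j, ?_, ?_⟩
  · intro i j
    rw [hg, ← hzz']
    simp only [Matrix.mul_apply, Fin.sum_univ_three]
    simp
    ring
  · have := congrFun (congrFun hzz 1) 0
    simpa [Matrix.mul_apply, Fin.sum_univ_three] using this

/-- The parametrisation. -/
def paramJ {K : Type*} [Field K] : K ⊕ K → GL (Fin 3) K × GL (Fin 3) K
  | Sum.inl c => (uniU 1 c 0, uniU 0 (-(1 + c)) 1)
  | Sum.inr c => (uniU 0 c 1, uniU 1 (-c) 0)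

theorem paramJ_injective {K : Type*} [Field K] : Function.Injective (paramJ (K := K)) := by
  have key : ∀ a b c a' b' c' : K, uniU a b c = uniU a' b' c' → a = a' ∧ b = b' := by
    intro a b c a' b' c' h
    have h1 := congrArg (fun g : GL (Fin 3) K => g.1 0 1) h
    have h2 := congrArg (fun g : GL (Fin 3) K => g.1 0 2) h
    simp [uniU] at h1 h2
    exact ⟨h1, h2⟩
  rintro (c | c) (d | d) h
  · rw [(key _ _ _ _ _ _ (congrArg Prod.fst h)).2]
  · exact absurd (key _ _ _ _ _ _ (congrArg Prod.fst h)).1 one_ne_zero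
  · exact absurd (key _ _ _ _ _ _ (congrArg Prod.fst h)).1 zero_ne_one
  · rw [(key _ _ _ _ _ _ (congrArg Prod.fst h)).2]

theorem paramJ_mul {K : Type*} [Field K] (s : K ⊕ K) :
    (((paramJ s).1 * (paramJ s).2 : GL (Fin 3) K) : Matrix (Fin 3) (Fin 3) K) =
        !![1, 1, 0; 0, 1, 1; 0, 0, 1] := by
  rcases s with c | c
  · change (!![1, 1, c; 0, 1, 0; 0, 0, 1] : Matrix (Fin 3) (Fin 3) K) *
      !![1, 0, -(1 + c); 0, 1, 1; 0, 0, 1] = _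
    ext i j; fin_cases i <;> fin_cases j <;> simp [Matrix.mul_apply, Fin.sum_univ_three]
  · change (!![1, 0, c; 0, 1, 1; 0, 0, 1] : Matrix (Fin 3) (Fin 3) K) *
      !![1, 1, -c; 0, 1, 0; 0, 0, 1] = _
    ext i j; fin_cases i <;> fin_cases j <;> simp [Matrix.mul_apply, Fin.sum_univ_three]

theorem factor_cases {K : Type*} [Field K] (g h : GL (Fin 3) K)
    (hg : ∃ z : GL (Fin 3) K,
      ((z * g * z⁻¹ : GL (Fin 3) K) : Matrix (Fin 3) (Fin 3) K) = !![1, 1, 0; 0, 1, 0; 0, 0, 1])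
    (hh : ∃ z : GL (Fin 3) K,
      ((z * h * z⁻¹ : GL (Fin 3) K) : Matrix (Fin 3) (Fin 3) K) = !![1, 1, 0; 0, 1, 0; 0, 0, 1])
    (hgh : ((g * h : GL (Fin 3) K) : Matrix (Fin 3) (Fin 3) K) =
        !![1, 1, 0; 0, 1, 1; 0, 0, 1]) :
    ∃ s, paramJ s = (g, h) := by
  suffices H : ∃ s : K ⊕ K, (paramJ s).1 = g by
    obtain ⟨s, hs⟩ := H
    refine ⟨s, Prod.ext hs ?_⟩
    have h1 : (paramJ s).1 * (paramJ s).2 = g * h := Units.ext ((paramJ_mul s).trans hgh.symm)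
    rw [hs] at h1
    exact mul_left_cancel h1
  obtain ⟨u, v, hA, huv⟩ := conj_outer g hg
  obtain ⟨x, y, hB, hxy⟩ := conj_outer h hh
  -- `g h - 1 = u vᵀ + w yᵀ` with `w = x + (v·x) u`
  obtain ⟨t, ht⟩ : ∃ t, t = v 0 * x 0 + v 1 * x 1 + v 2 * x 2 := ⟨_, rfl⟩
  obtain ⟨w, hw⟩ : ∃ w : Fin 3 → K, ∀ i, w i = x i + t * u i := ⟨_, fun i => rfl⟩
  have hN : ∀ i j, u i * v j + w i * y j =
      (!![0, 1, 0; 0, 0, 1; 0, 0, 0] : Matrix (Fin 3) (Fin 3) K) i j := by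
    intro i j
    have h1 := congrFun (congrFun hgh i) j
    rw [Units.val_mul, Matrix.mul_apply, Fin.sum_univ_three] at h1
    simp only [hA, hB] at h1
    rw [hw, ht]
    fin_cases i <;> fin_cases j <;> simp [Matrix.one_apply] at h1 ⊢ <;> linear_combination h1
  have e00 := hN 0 0
  have e01 := hN 0 1
  have e02 := hN 0 2
  have e10 := hN 1 0
  have e11 := hN 1 1
  have e12 := hN 1 2
  have e20 := hN 2 0
  have e21 := hN 2 1
  have e22 := hN 2 2
  simp at e00 e01 e02 e10 e11 e12 e20 e21 e22
  have hdet : (u 0 * w 1 - u 1 * w 0) * (v 1 * y 2 - v 2 * y 1) = 1 := by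
    linear_combination (u 1 * v 2 + w 1 * y 2) * e01 + e12 - (u 1 * v 1 + w 1 * y 1) * e02
  obtain ⟨hC, hD⟩ := mul_ne_zero_iff.mp (hdet ▸ one_ne_zero)
  have hu2 : u 2 = 0 := (mul_eq_zero.mp (show u 2 * (v 1 * y 2 - v 2 * y 1) = 0 by
    linear_combination y 2 * e21 - y 1 * e22)).resolve_right hD
  have hw2 : w 2 = 0 := (mul_eq_zero.mp (show w 2 * (v 1 * y 2 - v 2 * y 1) = 0 by
    linear_combination v 1 * e22 - v 2 * e21)).resolve_right hD
  have hv0 : v 0 = 0 := (mul_eq_zero.mp (show v 0 * (u 0 * w 1 - u 1 * w 0) = 0 by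
    linear_combination w 1 * e00 - w 0 * e10)).resolve_right hC
  have hy0 : y 0 = 0 := (mul_eq_zero.mp (show y 0 * (u 0 * w 1 - u 1 * w 0) = 0 by
    linear_combination u 0 * e10 - u 1 * e00)).resolve_right hC
  have hx2 : x 2 = 0 := by
    have := hw 2
    rw [hu2, hw2] at this
    linear_combination -this
  have hvu : v 1 * u 1 = 0 := by rw [hv0, hu2] at huv; linear_combination huv
  have hyx : y 1 * x 1 = 0 := by rw [hy0, hx2] at hxy; linear_combination hxy
  have ht' : t = v 1 * x 1 := by rw [ht, hv0, hx2]; ring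
  have hw1 := hw 1
  rcases mul_eq_zero.mp hvu with hv1 | hu1
  · have ht0 : t = 0 := by rw [ht', hv1]; ring
    have hy1 : y 1 ≠ 0 := by
      intro h0
      rw [h0, hv1] at e01
      simp at e01
    have hx1 := (mul_eq_zero.mp hyx).resolve_left hy1
    have hw10 : w 1 = 0 := by rw [hw1, hx1, ht0]; ring
    have huv1 : u 1 * v 2 = 1 := by rw [hw10] at e12; linear_combination e12
    refine ⟨Sum.inr (u 0 * v 2), Units.ext ?_⟩
    change (!![1, 0, u 0 * v 2; 0, 1, 1; 0, 0, 1] : Matrix (Fin 3) (Fin 3) K) = g.1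
    ext i j
    rw [hA]
    fin_cases i <;> fin_cases j <;> simp [hu2, hv0, hv1, huv1]
  · have hw1x : w 1 = x 1 := by rw [hw1, hu1]; ring
    have hx1 : x 1 ≠ 0 := by
      intro h0
      rw [hw1x, h0, hu1] at e12
      simp at e12
    have hy1 := (mul_eq_zero.mp hyx).resolve_right hx1
    have huv1 : u 0 * v 1 = 1 := by rw [hy1] at e01; linear_combination e01
    refine ⟨Sum.inl (u 0 * v 2), Units.ext ?_⟩
    change (!![1, 1, u 0 * v 2; 0, 1, 0; 0, 0, 1] : Matrix (Fin 3) (Fin 3) K) = g.1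
    ext i j
    rw [hA]
    fin_cases i <;> fin_cases j <;> simp [hu2, hv0, hu1, huv1]

/-- The number of pairs `(g, h)` in `GL_3(𝔽_q)` with `g ∼ J_2(1) ⊕ I_1`,
`h ∼ J_2(1) ⊕ I_1` and `g·h = J_3(1)` equals `2q`. This is the structure
constant `a^{(2)_{t-1}}_{(1)_{t-1}, (1)_{t-1}}` of the stable center. -/
theorem structure_constant_J3 (q : ℕ) (hq : Fintype.card F = q) :
    Nat.card {gh : GL (Fin 3) F × GL (Fin 3) F |
      (∃ z : GL (Fin 3) F,
        ((z * gh.1 * z⁻¹ : GL (Fin 3) F) : Matrix (Fin 3) (Fin 3) F) =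
          !![1, 1, 0; 0, 1, 0; 0, 0, 1]) ∧
      (∃ z : GL (Fin 3) F,
        ((z * gh.2 * z⁻¹ : GL (Fin 3) F) : Matrix (Fin 3) (Fin 3) F) =
          !![1, 1, 0; 0, 1, 0; 0, 0, 1]) ∧
      ((gh.1 * gh.2 : GL (Fin 3) F) : Matrix (Fin 3) (Fin 3) F) =
        !![1, 1, 0; 0, 1, 1; 0, 0, 1]} = 2 * q := by
  have hset : {gh : GL (Fin 3) F × GL (Fin 3) F |
      (∃ z : GL (Fin 3) F,
        ((z * gh.1 * z⁻¹ : GL (Fin 3) F) : Matrix (Fin 3) (Fin 3) F) =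
          !![1, 1, 0; 0, 1, 0; 0, 0, 1]) ∧
      (∃ z : GL (Fin 3) F,
        ((z * gh.2 * z⁻¹ : GL (Fin 3) F) : Matrix (Fin 3) (Fin 3) F) =
          !![1, 1, 0; 0, 1, 0; 0, 0, 1]) ∧
      ((gh.1 * gh.2 : GL (Fin 3) F) : Matrix (Fin 3) (Fin 3) F) =
        !![1, 1, 0; 0, 1, 1; 0, 0, 1]} = Set.range (paramJ (K := F)) := by
    ext ⟨g, h⟩
    constructor
    · rintro ⟨hg, hh, hgh⟩
      exact factor_cases g h hg hh hgh
    · rintro ⟨s, hs⟩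
      rw [← hs]
      refine ⟨?_, ?_, paramJ_mul s⟩
      · rcases s with c | c
        · exact conj_first c
        · exact conj_second c
      · rcases s with c | c
        · exact conj_second _
        · exact conj_first _
  rw [hset, Nat.card_range_of_injective paramJ_injective, Nat.card_sum, Nat.card_eq_fintype_card, hq]
  ring
end
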